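/- Let D and d_eq be positive integers with d_eq ≤ D, and let S_ε denote the set of unitary D×D matrices U such that for every row index α one has ∑_{β=1}^{d_eq} |U_{αβ}|² > 1 − ε. Then for every ε ∈ (0,1), if d_eq > (1 − ε/2)·D, the Haar probability measure of S_ε is at least 1 − 4·D·exp( −D ε² / 384 ). -/

import Mathlib

open MeasureTheory Matrix Filter

noncomputable instance (D : ℕ) : MeasurableSpace (Matrix.unitaryGroup (Fin D) ℂ) :=
  borel _

instance (D : ℕ) : BorelSpace (Matrix.unitaryGroup (Fin D) ℂ) := ⟨rfl⟩

open scoped ENNReal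

/-- The Gaussian integral over `ℂⁿ` with independent coordinate weights. -/
lemma lintegral_gaussian_pi {ι : Type*} [Fintype ι] (c : ι → ℝ) (hc : ∀ i, 0 < c i) :
    ∫⁻ z : ι → ℂ, ENNReal.ofReal (Real.exp (-∑ i, c i * ‖z i‖ ^ 2)) =
      ENNReal.ofReal (∏ i, (Real.pi / c i)) := by
  have key : ∫ z : ι → ℂ, Real.exp (-∑ i, c i * ‖z i‖ ^ 2) = ∏ i, (Real.pi / c i) := by
    have h1 : ∀ z : ι → ℂ, Real.exp (-∑ i, c i * ‖z i‖ ^ 2) =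
        ∏ i, Real.exp (-c i * ‖z i‖ ^ 2) := fun z => by
      rw [← Real.exp_sum, ← Finset.sum_neg_distrib]
      simp only [neg_mul]
    simp_rw [h1]
    rw [integral_fintype_prod_volume_eq_prod (fun i (w : ℂ) => Real.exp (-c i * ‖w‖ ^ 2))]
    refine Finset.prod_congr rfl fun i _ => ?_
    rw [GaussianFourier.integral_rexp_neg_mul_sq_norm (hc i)]
    simp
  have hpos : 0 < ∏ i, (Real.pi / c i) :=
    Finset.prod_pos fun i _ => div_pos Real.pi_pos (hc i)
  rw [← key, ofReal_integral_eq_lintegral_ofReal]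
  · exact Integrable.of_integral_ne_zero (by rw [key]; exact hpos.ne')
  · exact ae_of_all _ fun z => (Real.exp_pos _).le

lemma ofReal_sum_norm_sq_eq_dotProduct {ι : Type*} [Fintype ι] (z : ι → ℂ) :
    ((∑ i, ‖z i‖ ^ 2 : ℝ) : ℂ) = z ⬝ᵥ star z := by
  simp [dotProduct, Complex.mul_conj, Complex.normSq_eq_norm_sq]

lemma sum_norm_sq_vecMul_unitary {ι : Type*} [Fintype ι] [DecidableEq ι]
    (U : Matrix.unitaryGroup ι ℂ) (z : ι → ℂ) :
    ∑ i, ‖(z ᵥ* (U : Matrix ι ι ℂ)) i‖ ^ 2 = ∑ i, ‖z i‖ ^ 2 := by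
  have hU : (U : Matrix ι ι ℂ) * (U : Matrix ι ι ℂ)ᴴ = 1 := Matrix.mem_unitaryGroup_iff.mp U.2
  have : ((∑ i, ‖(z ᵥ* (U : Matrix ι ι ℂ)) i‖ ^ 2 : ℝ) : ℂ) = ((∑ i, ‖z i‖ ^ 2 : ℝ) : ℂ) := by
    rw [ofReal_sum_norm_sq_eq_dotProduct, ofReal_sum_norm_sq_eq_dotProduct, Matrix.star_vecMul,
      ← Matrix.dotProduct_mulVec, Matrix.mulVec_mulVec, hU, Matrix.one_mulVec]
  exact_mod_cast this

lemma measurePreserving_vecMul_unitary {ι : Type*} [Fintype ι] [DecidableEq ι]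
    (U : Matrix.unitaryGroup ι ℂ) :
    MeasurePreserving (fun z : ι → ℂ => z ᵥ* (U : Matrix ι ι ℂ)) := by
  let L : (ι → ℂ) →ₗ[ℝ] (ι → ℂ) := (Matrix.vecMulLinear (U : Matrix ι ι ℂ)).restrictScalars ℝ
  have hL : ∀ z, L z = z ᵥ* (U : Matrix ι ι ℂ) := fun z => rfl
  have hLm : Measurable L := L.continuous_of_finiteDimensional.measurable
  have hinj : Function.Injective L := fun x y hxy => by
    have hU : (U : Matrix ι ι ℂ) * (U : Matrix ι ι ℂ)ᴴ = 1 := Matrix.mem_unitaryGroup_iff.mp U.2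
    have := congrArg (fun v => v ᵥ* (U : Matrix ι ι ℂ)ᴴ) hxy
    simpa [hL, Matrix.vecMul_vecMul, hU] using this
  have hdet : LinearMap.det L ≠ 0 := by
    have : IsUnit L := (Module.End.isUnit_iff L).2
      ⟨hinj, LinearMap.injective_iff_surjective.1 hinj⟩
    exact (LinearMap.isUnit_det L this).ne_zero
  have hmap := Measure.map_linearMap_addHaar_eq_smul_addHaar (volume : Measure (ι → ℂ)) hdet
  set c := ENNReal.ofReal |(LinearMap.det L)⁻¹|
  let g : (ι → ℂ) → ℝ≥0∞ := fun z => ENNReal.ofReal (Real.exp (-∑ i, (1 : ℝ) * ‖z i‖ ^ 2))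
  have hg : Measurable g := by fun_prop
  have hI : ∫⁻ z, g z = ENNReal.ofReal (∏ _i : ι, (Real.pi / 1)) :=
    lintegral_gaussian_pi (fun _ => 1) (fun _ => one_pos)
  have hI0 : ∫⁻ z, g z ≠ 0 := by
    rw [hI]
    exact (ENNReal.ofReal_pos.2 (Finset.prod_pos fun i _ => by positivity)).ne'
  have hIt : ∫⁻ z, g z ≠ ∞ := by rw [hI]; exact ENNReal.ofReal_ne_top
  have h1 : ∫⁻ z, g z = c * ∫⁻ z, g z := by
    conv_rhs => rw [← smul_eq_mul, ← lintegral_smul_measure, ← hmap, lintegral_map hg hLm]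
    refine lintegral_congr fun z => ?_
    simp only [g, one_mul, hL, sum_norm_sq_vecMul_unitary]
  have hc : c = 1 := by
    have h2 : 1 * ∫⁻ z, g z = c * ∫⁻ z, g z := by rw [one_mul]; exact h1
    exact ((ENNReal.mul_left_inj hI0 hIt).1 h2).symm
  exact ⟨hLm, by rw [hc, one_smul] at hmap; exact hmap⟩

/-- The unitary group acts transitively on the rays of `ℂⁿ`. -/
lemma exists_unitary_row {ι : Type*} [Fintype ι] [DecidableEq ι] (α : ι) (z : ι → ℂ)
    (hz : z ≠ 0) :
    ∃ (V : Matrix.unitaryGroup ι ℂ) (r : ℝ), r ≠ 0 ∧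
      z = (r : ℂ) • (V : Matrix ι ι ℂ) α := by
  let w : EuclideanSpace ℂ ι := WithLp.toLp 2 z
  have hw : w ≠ 0 := fun h => hz (by simpa [w] using h)
  let u : EuclideanSpace ℂ ι := ((‖w‖⁻¹ : ℝ) : ℂ) • w
  have hnw : ‖w‖ ≠ 0 := norm_ne_zero_iff.2 hw
  have hu : ‖u‖ = 1 := by simp [u, norm_smul, hnw]
  have hon : Orthonormal ℂ (({α} : Set ι).domRestrict (fun _ => u)) := by
    rw [orthonormal_iff_ite]
    rintro ⟨i, hi⟩ ⟨j, hj⟩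
    obtain rfl : i = α := hi
    obtain rfl : j = i := hj
    simp [inner_self_eq_norm_sq_to_K, hu]
  obtain ⟨b, hb⟩ := hon.exists_orthonormalBasis_extension_of_card_eq (by simp)
  have hbα : b α = u := hb α rfl
  let V : Matrix ι ι ℂ := Matrix.of fun i j => b i j
  have hV : V ∈ Matrix.unitaryGroup ι ℂ := by
    rw [Matrix.mem_unitaryGroup_iff]
    ext i j
    have := orthonormal_iff_ite.1 b.orthonormal j i
    rw [PiLp.inner_apply] at this
    simpa [V, Matrix.mul_apply, Matrix.star_apply, Matrix.one_apply, eq_comm] using this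
  refine ⟨⟨V, hV⟩, ‖w‖, hnw, ?_⟩
  funext j
  have : V α j = u j := by simp [V, hbα]
  simp only [Pi.smul_apply, smul_eq_mul, this]
  have hc : (‖w‖ : ℂ) ≠ 0 := by exact_mod_cast hnw
  simp [u, w, hc]

/-- Averaging over the Haar measure and over a Gaussian vector: the law of a row of a Haar unitary
is the law of a normalised Gaussian vector. -/
lemma haar_row_mul_gaussian {D : ℕ}
    (μ : Measure (Matrix.unitaryGroup (Fin D) ℂ)) [μ.IsHaarMeasure] [IsProbabilityMeasure μ]
    (T : Finset (Fin D)) (ε : ℝ) (α : Fin D) :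
    μ {U | ε ≤ ∑ β ∈ T, ‖(U : Matrix (Fin D) (Fin D) ℂ) α β‖ ^ 2} *
        ∫⁻ z : Fin D → ℂ, ENNReal.ofReal (Real.exp (-∑ i, ‖z i‖ ^ 2)) =
      ∫⁻ z : Fin D → ℂ, {z : Fin D → ℂ | ε * ∑ i, ‖z i‖ ^ 2 ≤ ∑ β ∈ T, ‖z β‖ ^ 2}.indicator
        (fun z => ENNReal.ofReal (Real.exp (-∑ i, ‖z i‖ ^ 2))) z := by
  set S := {U : Matrix.unitaryGroup (Fin D) ℂ |
    ε ≤ ∑ β ∈ T, ‖(U : Matrix (Fin D) (Fin D) ℂ) α β‖ ^ 2} with hS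
  set A := {z : Fin D → ℂ | ε * ∑ i, ‖z i‖ ^ 2 ≤ ∑ β ∈ T, ‖z β‖ ^ 2} with hA
  set g : (Fin D → ℂ) → ℝ≥0∞ := fun z => ENNReal.ofReal (Real.exp (-∑ i, ‖z i‖ ^ 2)) with hgdef
  have hg : Measurable g := by fun_prop
  have hAm : MeasurableSet A := measurableSet_le (by fun_prop) (by fun_prop)
  have hentry : ∀ i j, Measurable fun U : Matrix.unitaryGroup (Fin D) ℂ =>
      (U : Matrix (Fin D) (Fin D) ℂ) i j := fun i j =>
    (continuous_subtype_val.matrix_elem i j).measurable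
  have hact : Measurable fun p : (Fin D → ℂ) × Matrix.unitaryGroup (Fin D) ℂ =>
      p.1 ᵥ* (p.2 : Matrix (Fin D) (Fin D) ℂ) := by
    refine measurable_pi_lambda _ fun j => ?_
    simp only [Matrix.vecMul, dotProduct]
    refine Finset.measurable_sum _ fun i _ => ?_
    exact ((measurable_pi_apply i).comp measurable_fst).mul ((hentry i j).comp measurable_snd)
  have hα0 : (volume : Measure (Fin D → ℂ)) {0} = 0 := by
    have : Nonempty (Fin D) := ⟨α⟩
    exact measure_singleton _
  have hAS : ∀ (V U : Matrix.unitaryGroup (Fin D) ℂ) (r : ℝ), r ≠ 0 →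
      (((r : ℂ) • (V : Matrix (Fin D) (Fin D) ℂ) α) ᵥ* (U : Matrix (Fin D) (Fin D) ℂ) ∈ A ↔
        V * U ∈ S) := by
    intro V U r hr
    have hrow : ∀ j, (((r : ℂ) • (V : Matrix (Fin D) (Fin D) ℂ) α) ᵥ*
        (U : Matrix (Fin D) (Fin D) ℂ)) j =
        r * ((V * U : Matrix.unitaryGroup (Fin D) ℂ) : Matrix (Fin D) (Fin D) ℂ) α j := by
      intro j
      rw [Matrix.smul_vecMul]
      rfl
    have hone : ∑ j, ‖((V * U : Matrix.unitaryGroup (Fin D) ℂ) :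
        Matrix (Fin D) (Fin D) ℂ) α j‖ ^ 2 = 1 := by
      have := sum_norm_sq_vecMul_unitary (V * U) (Pi.single α 1)
      rw [Matrix.single_one_vecMul] at this
      refine this.trans ?_
      rw [Finset.sum_eq_single α] <;> simp +contextual
    simp only [hA, hS, Set.mem_ofPred_eq, hrow, norm_mul, mul_pow, ← Finset.mul_sum, hone]
    have hr2 : 0 < ‖(r : ℂ)‖ ^ 2 := by
      have : (r : ℂ) ≠ 0 := by exact_mod_cast hr
      positivity
    rw [mul_one, mul_comm ε, mul_le_mul_iff_right₀ hr2]
  have hinner : ∀ z : Fin D → ℂ, z ≠ 0 →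
      ∫⁻ U, A.indicator g (z ᵥ* (U : Matrix (Fin D) (Fin D) ℂ)) ∂μ = μ S * g z := by
    intro z hz
    obtain ⟨V, r, hr, rfl⟩ := exists_unitary_row α z hz
    have hSm : MeasurableSet ((fun U => V * U) ⁻¹' S) := by
      have : (fun U => V * U) ⁻¹' S = {U : Matrix.unitaryGroup (Fin D) ℂ |
          ((r : ℂ) • (V : Matrix (Fin D) (Fin D) ℂ) α) ᵥ* (U : Matrix (Fin D) (Fin D) ℂ) ∈ A} := by
        ext U
        exact (hAS V U r hr).symm
      rw [this]
      exact (hact.comp measurable_prodMk_left) hAm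
    have : ∀ U : Matrix.unitaryGroup (Fin D) ℂ, A.indicator g
        (((r : ℂ) • (V : Matrix (Fin D) (Fin D) ℂ) α) ᵥ* (U : Matrix (Fin D) (Fin D) ℂ)) =
        ((fun U => V * U) ⁻¹' S).indicator
          (fun _ => g ((r : ℂ) • (V : Matrix (Fin D) (Fin D) ℂ) α)) U := by
      intro U
      by_cases h : V * U ∈ S
      · rw [Set.indicator_of_mem ((hAS V U r hr).2 h), Set.indicator_of_mem (by exact h)]
        simp only [hgdef, sum_norm_sq_vecMul_unitary]
      · rw [Set.indicator_of_notMem (fun h' => h ((hAS V U r hr).1 h')),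
          Set.indicator_of_notMem (by exact h)]
    simp_rw [this]
    rw [lintegral_indicator_const hSm, measure_preimage_mul, mul_comm]
  calc μ S * ∫⁻ z, g z = ∫⁻ z, μ S * g z := (lintegral_const_mul _ hg).symm
    _ = ∫⁻ z : Fin D → ℂ, ∫⁻ U, A.indicator g (z ᵥ* (U : Matrix (Fin D) (Fin D) ℂ)) ∂μ := by
        refine lintegral_congr_ae ?_
        filter_upwards [compl_mem_ae_iff.2 hα0] with z hz
        exact (hinner z hz).symm
    _ = ∫⁻ U, (∫⁻ z : Fin D → ℂ, A.indicator g (z ᵥ* (U : Matrix (Fin D) (Fin D) ℂ))) ∂μ :=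
        lintegral_lintegral_swap ((hg.indicator hAm).comp hact).aemeasurable
    _ = ∫⁻ _U, (∫⁻ z : Fin D → ℂ, A.indicator g z) ∂μ :=
        lintegral_congr fun U =>
          (measurePreserving_vecMul_unitary U).lintegral_comp (hg.indicator hAm)
    _ = ∫⁻ z, A.indicator g z := by simp

/-- The Chernoff factor, with exponential parameter `1 / 2`. -/
lemma prod_chernoff_le {ι : Type*} [Fintype ι] [DecidableEq ι] (T : Finset ι)
    (ε : ℝ) (hε : ε ∈ Set.Ioo (0 : ℝ) 1)
    (hT : (T.card : ℝ) ≤ ε / 2 * Fintype.card ι) :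
    ∏ i, (1 / (1 + ε / 2 - if i ∈ T then 1 / 2 else 0)) ≤
      Real.exp (-(Fintype.card ι * ε ^ 2) / 6) := by
  obtain ⟨h0, h1⟩ := hε
  have hne1 : 1 + ε ≠ 0 := by linarith
  have hne2 : 2 + ε ≠ 0 := by linarith
  have hfac : ∀ i, 1 / (1 + ε / 2 - if i ∈ T then (1 : ℝ) / 2 else 0) ≤
      Real.exp (-(ε / (2 + ε)) + if i ∈ T then (1 - ε) / (1 + ε) + ε / (2 + ε) else 0) := by
    intro i
    split_ifs
    · refine le_trans (le_of_eq ?_) (Real.add_one_le_exp _)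
      rw [show 1 + ε / 2 - 1 / 2 = (1 + ε) / 2 by ring]
      field_simp
      ring
    · refine le_trans (le_of_eq ?_) (Real.add_one_le_exp _)
      rw [show 1 + ε / 2 - 0 = (2 + ε) / 2 by ring]
      field_simp
      ring
  have hpos : ∀ i, 0 ≤ 1 / (1 + ε / 2 - if i ∈ T then (1 : ℝ) / 2 else 0) := by
    intro i
    apply one_div_nonneg.2
    split_ifs <;> linarith
  refine (Finset.prod_le_prod (fun i _ => hpos i) fun i _ => hfac i).trans ?_
  rw [← Real.exp_sum, Finset.sum_add_distrib, ← Finset.sum_filter]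
  simp only [Finset.sum_const, Finset.card_univ, nsmul_eq_mul]
  rw [Finset.filter_univ_mem]
  apply Real.exp_le_exp.2
  set n : ℝ := (Fintype.card ι : ℝ)
  have hn : 0 ≤ n := Nat.cast_nonneg _
  have hq : 0 ≤ (1 - ε) / (1 + ε) + ε / (2 + ε) := by
    have : 0 ≤ 1 - ε := by linarith
    positivity
  have hstep := mul_le_mul_of_nonneg_right hT hq
  have hid : n * -(ε / (2 + ε)) + ε / 2 * n * ((1 - ε) / (1 + ε) + ε / (2 + ε)) =
      -(n * ε ^ 2) / ((1 + ε) * (2 + ε)) := by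
    field_simp
    ring
  have hlast : -(n * ε ^ 2) / ((1 + ε) * (2 + ε)) ≤ -(n * ε ^ 2) / 6 := by
    rw [neg_div, neg_div, neg_le_neg_iff]
    apply div_le_div_of_nonneg_left (by positivity) (by positivity)
    nlinarith
  linarith

lemma haar_row_tail {D : ℕ}
    (μ : Measure (Matrix.unitaryGroup (Fin D) ℂ)) [μ.IsHaarMeasure] [IsProbabilityMeasure μ]
    (T : Finset (Fin D)) (ε : ℝ) (hε : ε ∈ Set.Ioo (0 : ℝ) 1)
    (hT : (T.card : ℝ) ≤ ε / 2 * D) (α : Fin D) :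
    μ {U | ε ≤ ∑ β ∈ T, ‖(U : Matrix (Fin D) (Fin D) ℂ) α β‖ ^ 2} ≤
      ENNReal.ofReal (Real.exp (-(D * ε ^ 2) / 6)) := by
  have hgauss := haar_row_mul_gaussian μ T ε α
  have hG := lintegral_gaussian_pi (fun _ : Fin D => (1 : ℝ)) (fun _ => one_pos)
  simp only [one_mul, div_one] at hG
  set c : Fin D → ℝ := fun i => 1 + ε / 2 - if i ∈ T then 1 / 2 else 0 with hcdef
  have hc : ∀ i, 0 < c i := by
    intro i
    have := hε.1
    simp only [hcdef]
    split_ifs <;> linarith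
  have hle : ∀ z : Fin D → ℂ,
      {z : Fin D → ℂ | ε * ∑ i, ‖z i‖ ^ 2 ≤ ∑ β ∈ T, ‖z β‖ ^ 2}.indicator
        (fun z => ENNReal.ofReal (Real.exp (-∑ i, ‖z i‖ ^ 2))) z ≤
      ENNReal.ofReal (Real.exp (-∑ i, c i * ‖z i‖ ^ 2)) := by
    intro z
    refine Set.indicator_apply_le' (fun hz => ?_) fun _ => zero_le
    apply ENNReal.ofReal_le_ofReal
    apply Real.exp_le_exp.2
    have hsum : ∑ i, c i * ‖z i‖ ^ 2 =
        (1 + ε / 2) * ∑ i, ‖z i‖ ^ 2 - 1 / 2 * ∑ β ∈ T, ‖z β‖ ^ 2 := by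
      simp only [hcdef, sub_mul, Finset.sum_sub_distrib, ← Finset.mul_sum, ite_mul, zero_mul]
      rw [← Finset.sum_filter, Finset.filter_univ_mem, ← Finset.mul_sum]
    have hz' : ε * ∑ i, ‖z i‖ ^ 2 ≤ ∑ β ∈ T, ‖z β‖ ^ 2 := hz
    linarith
  have hprod : ∏ i, (Real.pi / c i) ≤
      Real.exp (-(D * ε ^ 2) / 6) * ∏ _i : Fin D, Real.pi := by
    have h := prod_chernoff_le T ε hε (by simpa using hT)
    have hsplit : ∏ i, (Real.pi / c i) = (∏ i, (1 / c i)) * ∏ _i : Fin D, Real.pi := by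
      rw [← Finset.prod_mul_distrib]
      exact Finset.prod_congr rfl fun i _ => by ring
    rw [hsplit]
    refine mul_le_mul_of_nonneg_right ?_ (Finset.prod_nonneg fun _ _ => Real.pi_pos.le)
    simpa only [Fintype.card_fin] using h
  have hfin := (hgauss.le.trans (lintegral_mono hle)).trans_eq (lintegral_gaussian_pi c hc)
  replace hfin := hfin.trans (ENNReal.ofReal_le_ofReal hprod)
  rw [hG, ENNReal.ofReal_mul (Real.exp_pos _).le] at hfin
  refine (ENNReal.mul_le_mul_iff_left ?_ ENNReal.ofReal_ne_top).1 hfin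
  exact (ENNReal.ofReal_pos.2 (Finset.prod_pos fun _ _ => Real.pi_pos)).ne'

/-- if `d_eq > (1 − ε/2)·D`, the Haar probability measure of
`S_ε = {U : ∀ α, ∑_{β=1}^{d_eq} |U_{αβ}|² > 1 − ε}` is at least
`1 − 4 D exp(−D ε²/384)`. -/
theorem stmt12 (D deq : ℕ) (hD : 0 < D) (hdeq : 0 < deq) (hle : deq ≤ D)
    (μ : Measure (Matrix.unitaryGroup (Fin D) ℂ))
    [μ.IsHaarMeasure] [IsProbabilityMeasure μ]
    (ε : ℝ) (hε : ε ∈ Set.Ioo (0:ℝ) 1)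
    (hdeqbig : (deq : ℝ) > (1 - ε/2) * D) :
    μ {U : Matrix.unitaryGroup (Fin D) ℂ |
        ∀ α : Fin D, (1 - ε) <
          ∑ β ∈ Finset.univ.filter (fun β : Fin D => (β : ℕ) < deq),
            ‖(U : Matrix (Fin D) (Fin D) ℂ) α β‖^2 }
      ≥ 1 - ENNReal.ofReal (4 * D * Real.exp (-(D * ε^2) / 384)) := by
  set S := {U : Matrix.unitaryGroup (Fin D) ℂ |
        ∀ α : Fin D, (1 - ε) <
          ∑ β ∈ Finset.univ.filter (fun β : Fin D => (β : ℕ) < deq),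
            ‖(U : Matrix (Fin D) (Fin D) ℂ) α β‖^2 } with hS
  let T : Finset (Fin D) := Finset.univ.filter fun β : Fin D => ¬ (β : ℕ) < deq
  have hTcard : (T.card : ℝ) ≤ ε / 2 * D := by
    have h := Finset.card_filter_add_card_filter_not
      (s := (Finset.univ : Finset (Fin D))) (fun β : Fin D => (β : ℕ) < deq)
    have h' : (Finset.univ.filter fun β : Fin D => (β : ℕ) < deq).card = deq := by
      rw [Fin.card_filter_val_lt, min_eq_right hle]
    rw [h', Finset.card_univ, Fintype.card_fin] at h
    have h'' : (deq : ℝ) + T.card = D := by exact_mod_cast h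
    linarith
  have hcover : Sᶜ ⊆ ⋃ α : Fin D, {U : Matrix.unitaryGroup (Fin D) ℂ |
      ε ≤ ∑ β ∈ T, ‖(U : Matrix (Fin D) (Fin D) ℂ) α β‖ ^ 2} := by
    intro U hU
    simp only [hS, Set.mem_compl_iff, Set.mem_ofPred_eq, not_forall, not_lt] at hU
    obtain ⟨α, hα⟩ := hU
    refine Set.mem_iUnion.2 ⟨α, ?_⟩
    have hone : ∑ j, ‖(U : Matrix (Fin D) (Fin D) ℂ) α j‖ ^ 2 = 1 := by
      have := sum_norm_sq_vecMul_unitary U (Pi.single α 1)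
      rw [Matrix.single_one_vecMul] at this
      refine this.trans ?_
      rw [Finset.sum_eq_single α] <;> simp +contextual
    rw [← Finset.sum_filter_add_sum_filter_not _ (fun β : Fin D => (β : ℕ) < deq)] at hone
    simp only [Set.mem_ofPred_eq, T]
    linarith
  have hcompl : μ Sᶜ ≤ ENNReal.ofReal (4 * D * Real.exp (-(D * ε ^ 2) / 384)) := by
    calc μ Sᶜ ≤ ∑ α : Fin D, μ {U : Matrix.unitaryGroup (Fin D) ℂ |
          ε ≤ ∑ β ∈ T, ‖(U : Matrix (Fin D) (Fin D) ℂ) α β‖ ^ 2} :=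
          (measure_mono hcover).trans (measure_iUnion_fintype_le _ _)
      _ ≤ ∑ _α : Fin D, ENNReal.ofReal (Real.exp (-(D * ε ^ 2) / 6)) :=
          Finset.sum_le_sum fun α _ => haar_row_tail μ T ε hε hTcard α
      _ = ENNReal.ofReal (D * Real.exp (-(D * ε ^ 2) / 6)) := by
          rw [ENNReal.ofReal_mul (Nat.cast_nonneg _)]
          simp
      _ ≤ _ := by
          apply ENNReal.ofReal_le_ofReal
          have hx : (0 : ℝ) ≤ D * ε ^ 2 := by positivity
          have he : Real.exp (-(D * ε ^ 2) / 6) ≤ Real.exp (-(D * ε ^ 2) / 384) :=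
            Real.exp_le_exp.2 (by linarith)
          have hDe : (0 : ℝ) ≤ D * Real.exp (-(D * ε ^ 2) / 384) := by positivity
          nlinarith [mul_le_mul_of_nonneg_left he (Nat.cast_nonneg (α := ℝ) D)]
  have htotal : 1 ≤ μ S + μ Sᶜ := by
    rw [← measure_univ (μ := μ), ← Set.union_compl_self S]
    exact measure_union_le _ _
  exact tsub_le_iff_right.2 (htotal.trans (by gcongr))
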